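/- Let 𝒰 be a finite set and let S : Set 𝒰 → Σ be a composable sketching map. Let I be a finite index set, let (Cᵢ)_{i∈I} be pairwise disjoint subsets of 𝒰, and let (Bᵢ)_{i∈I} be subsets of 𝒰 such that for each i: ⋃_{j≠i} Cⱼ ⊆ Bᵢ, Cᵢ ∩ Bᵢ = ∅, and every D ∈ InCores(Bᵢ ∪ Cᵢ) satisfies Cᵢ ⊆ D. Then C := ⋃_{i∈I} Cᵢ is a core of S(C), i.e., C ∈ InCores(C). In particular, if every core of every sketch value of S has size at most k, then |C| ≤ k. -/

import Mathlib

/-- A sketching map `S` on ground set `𝒰` is *composable* if there is a binary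
operation `op` on sketch values with `S (A ∪ B) = op (S A) (S B)` for all `A B`. -/
def Composable {𝒰 T : Type*} (S : Set 𝒰 → T) : Prop :=
  ∃ op : T → T → T, ∀ A B : Set 𝒰, S (A ∪ B) = op (S A) (S B)

/-- `C` is a *core* of the sketch value `σ`: `S C = σ` and no proper subset of
`C` has sketch `σ`. -/
def IsCore {𝒰 T : Type*} (S : Set 𝒰 → T) (σ : T) (C : Set 𝒰) : Prop :=
  S C = σ ∧ ∀ C' : Set 𝒰, C' ⊂ C → S C' ≠ σ

/-- `InCores S U` is the collection of cores of `S U` that are contained in `U`. -/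
def InCores {𝒰 T : Type*} (S : Set 𝒰 → T) (U : Set 𝒰) : Set (Set 𝒰) :=
  {C : Set 𝒰 | IsCore S (S U) C ∧ C ⊆ U}

theorem Composable.union_congr_right {𝒰 T : Type*} {S : Set 𝒰 → T} (hS : Composable S)
    (B : Set 𝒰) {U V : Set 𝒰} (h : S U = S V) : S (B ∪ U) = S (B ∪ V) := by
  obtain ⟨op, hop⟩ := hS
  rw [hop, hop, h]

/-- On a finite ground set, every set contains a core of its sketch value. -/
theorem exists_isCore_subset {𝒰 T : Type*} [Finite 𝒰] {S : Set 𝒰 → T} {σ : T} {U : Set 𝒰}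
    (hU : S U = σ) : ∃ D, IsCore S σ D ∧ D ⊆ U := by
  obtain ⟨D, hDU, hD⟩ := (Set.toFinite {D | S D = σ}).exists_le_minimal hU
  exact ⟨D, ⟨hD.prop, fun D' hD' h => hD.not_prop_of_lt hD' h⟩, hDU⟩

/-- There can be at most `k` yields: the union `C` of the pairwise disjoint
yields `Cᵢ` is a core of `S C`; in particular, if every core of every sketch
value has size at most `k`, then `|C| ≤ k`. -/
theorem stmt11 {𝒰 T : Type*} [Fintype 𝒰] (S : Set 𝒰 → T) (hS : Composable S)
    {ι : Type*} [Fintype ι] (C B : ι → Set 𝒰)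
    (hdisj : ∀ i j : ι, i ≠ j → Disjoint (C i) (C j))
    (hsub : ∀ i j : ι, j ≠ i → C j ⊆ B i)
    (hCB : ∀ i : ι, Disjoint (C i) (B i))
    (hyield : ∀ i : ι, ∀ D ∈ InCores S (B i ∪ C i), C i ⊆ D) :
    (⋃ i, C i) ∈ InCores S (⋃ i, C i) ∧
    (∀ k : ℕ, (∀ σ ∈ Set.range S, ∀ D : Set 𝒰, IsCore S σ D → D.ncard ≤ k) →
      (⋃ i, C i).ncard ≤ k) := by
  have hcore : (⋃ i, C i) ∈ InCores S (⋃ i, C i) := by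
    refine ⟨⟨rfl, fun C' hC' hSC' => ?_⟩, subset_rfl⟩
    obtain ⟨x, hx, hxC'⟩ := Set.exists_of_ssubset hC'
    obtain ⟨i, hxi⟩ := Set.mem_iUnion.mp hx
    have hunion : B i ∪ ⋃ j, C j = B i ∪ C i := by
      refine subset_antisymm ?_ (Set.union_subset_union_right _ (Set.subset_iUnion C i))
      refine Set.union_subset Set.subset_union_left (Set.iUnion_subset fun j => ?_)
      rcases eq_or_ne j i with rfl | hji
      · exact Set.subset_union_right
      · exact (hsub i j hji).trans Set.subset_union_left
    have hS' : S (B i ∪ C') = S (B i ∪ C i) := by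
      rw [← hunion]
      exact hS.union_congr_right (B i) hSC'
    obtain ⟨D, hD, hDsub⟩ := exists_isCore_subset hS'
    have hDin : D ∈ InCores S (B i ∪ C i) :=
      ⟨hD, hDsub.trans (hunion ▸ Set.union_subset_union_right _ hC'.subset)⟩
    rcases hDsub (hyield i D hDin hxi) with hxB | hxC
    · exact Set.disjoint_left.mp (hCB i) hxi hxB
    · exact hxC' hxC
  exact ⟨hcore, fun k hk => hk _ (Set.mem_range_self _) _ hcore.1⟩
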